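/- Let a,b≥0, −1<c,d≤0, 0≤q<1 with ab<1. Fix d∈ℕ, reals 0<θ₁<…<θ_d<θ_{d+1}=1, and reals 0<u_j<v_j for j=1,…,d+1 satisfying v_{d+1}−u_j < 1−θ_j for j=1,…,d. Let Val_N := {λ∈TL_N : h_N[λ](θ_j) ∈ (u_j,v_j) for j=1,…,d+1}, and assume Val_N is nonempty for all sufficiently large N. Then lim_{N→∞} (1/N) · [ log ∑_{λ∈Val_N} wt_N^{(q,a,b,c,d)}(λ) − log ∑_{λ∈Val_N} wt_N^{(0,a,b,0,0)}(λ) ] = 0. -/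

import Mathlib

/-- A Bernoulli path on `{0,…,N}`: increments in `{0,1}`. -/
def IsBPath (N : ℕ) (L : Fin (N+1) → ℤ) : Prop :=
  ∀ j : Fin N, L j.succ = L j.castSucc ∨ L j.succ = L j.castSucc + 1

/-- The two-layer configuration space `TL_N`. -/
def TLset (N : ℕ) : Set ((Fin (N+1) → ℤ) × (Fin (N+1) → ℤ)) :=
  {p | p.1 0 = 0 ∧ (∀ j, p.2 j ≤ p.1 j) ∧ IsBPath N p.1 ∧ IsBPath N p.2}

/-- The finite q-Pochhammer symbol `(z;q)_n = ∏_{j=0}^{n-1} (1 - z qʲ)`. -/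
noncomputable def qPoch (z q : ℝ) (n : ℕ) : ℝ := ∏ j ∈ Finset.range n, (1 - z * q ^ j)

/-- The local weight `W^{(q,c,d)}(x | u,v)`. -/
noncomputable def Wfac (q c d : ℝ) (x u v : ℤ) : ℝ :=
  if u = 1 ∧ v = 0 then 1 - q ^ x.toNat
  else if u = 1 ∧ v = 1 then 1 + d * q ^ x.toNat
  else if u = 0 ∧ v = 0 then 1 + c * q ^ x.toNat
  else 1 - c * d * q ^ x.toNat

/-- The two-layer weight `wt_N^{(q,a,b,c,d)}`. -/
noncomputable def twt (N : ℕ) (q a b c d : ℝ) (p : (Fin (N+1) → ℤ) × (Fin (N+1) → ℤ)) : ℝ :=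
  a ^ (p.1 0 - p.2 0).toNat * b ^ (p.1 (Fin.last N) - p.2 (Fin.last N)).toNat *
    (qPoch (c * d) q (p.1 (Fin.last N) - p.2 (Fin.last N)).toNat /
      qPoch q q (p.1 (Fin.last N) - p.2 (Fin.last N)).toNat) *
    ∏ j : Fin N, Wfac q c d (p.1 j.succ - p.2 j.succ)
      (p.1 j.succ - p.1 j.castSucc) (p.2 j.succ - p.2 j.castSucc)

/-- The open TASEP two-layer weight `wt_N^{(0,a,b,0,0)}(λ) = a^{λ₁(0)-λ₂(0)} b^{λ₁(N)-λ₂(N)}`. -/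
noncomputable def twt0 (N : ℕ) (a b : ℝ) (p : (Fin (N+1) → ℤ) × (Fin (N+1) → ℤ)) : ℝ :=
  a ^ (p.1 0 - p.2 0).toNat * b ^ (p.1 (Fin.last N) - p.2 (Fin.last N)).toNat

/-- The rescaled height profile `h_N[λ] : [0,1] → ℝ` of the first layer: it takes the value
`λ₁(k)/N` at `k/N` and is linearly interpolated in between. -/
noncomputable def heightTL (N : ℕ) (lam : Fin (N+1) → ℤ) (t : ℝ) : ℝ :=
  (N : ℝ)⁻¹ * ((lam 0 : ℝ) +
    ∑ k : Fin N, ((lam k.succ - lam k.castSucc : ℤ) : ℝ) * min 1 (max 0 ((N : ℝ) * t - (k : ℕ))))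

section BernoulliPaths

variable {N : ℕ}

lemma Fin.sum_succ_sub_castSucc {G : Type*} [AddCommGroup G] (f : Fin (N + 1) → G) :
    ∑ j : Fin N, (f j.succ - f j.castSucc) = f (Fin.last N) - f 0 := by
  induction N with
  | zero => simp
  | succ n ih =>
    rw [Fin.sum_univ_castSucc]
    have := ih (fun j => f j.castSucc)
    simp only [Fin.succ_castSucc, Fin.castSucc_zero] at this ⊢
    rw [this, Fin.succ_last]
    abel

lemma Fin.eq_of_succ_sub_eq {f g : Fin (N + 1) → ℤ} (h0 : f 0 = g 0)
    (h : ∀ j : Fin N, f j.succ - f j.castSucc = g j.succ - g j.castSucc) : f = g := by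
  ext j
  induction j using Fin.induction with
  | zero => exact h0
  | succ i ih => have := h i; omega

/-- A monotone integer sequence with values in `[0, m]` changes at most `m` times. -/
lemma card_ne_succ_le_of_monotone {m : ℕ} {f : Fin (N + 1) → ℤ} (hf : Monotone f)
    (h0 : ∀ j, 0 ≤ f j) (hm : ∀ j, f j ≤ m) :
    (Finset.univ.filter fun j : Fin N => f j.succ ≠ f j.castSucc).card ≤ m := by
  have h1 : ((Finset.univ.filter fun j : Fin N => f j.succ ≠ f j.castSucc).card : ℤ)
      ≤ ∑ j : Fin N, (f j.succ - f j.castSucc) := by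
    rw [Finset.card_filter]
    push_cast
    refine Finset.sum_le_sum fun j _ => ?_
    have := hf j.castSucc_lt_succ.le
    split_ifs <;> omega
  rw [Fin.sum_succ_sub_castSucc] at h1
  have := h0 0
  have := hm (Fin.last N)
  omega

lemma card_ne_succ_le_of_antitone {m : ℕ} {f : Fin (N + 1) → ℤ} (hf : Antitone f)
    (h0 : ∀ j, 0 ≤ f j) (hm : ∀ j, f j ≤ m) :
    (Finset.univ.filter fun j : Fin N => f j.succ ≠ f j.castSucc).card ≤ m := by
  have h := card_ne_succ_le_of_monotone (m := m) (f := fun j => m - f j)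
    (fun i j hij => by have := hf hij; simp only; omega)
    (fun j => by have := hm j; omega) (fun j => by have := h0 j; omega)
  refine le_trans (Finset.card_le_card fun j => ?_) h
  simp only [Finset.mem_filter, Finset.mem_univ, true_and]
  omega

namespace IsBPath

variable {L M : Fin (N + 1) → ℤ}

lemma max (hL : IsBPath N L) (hM : IsBPath N M) : IsBPath N fun j => max (L j) (M j) := by
  intro j
  have := hL j
  have := hM j
  simp only
  omega

lemma min (hL : IsBPath N L) (hM : IsBPath N M) : IsBPath N fun j => min (L j) (M j) := by
  intro j
  have := hL j
  have := hM j
  simp only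
  omega

lemma add_const (hL : IsBPath N L) (z : ℤ) : IsBPath N fun j => L j + z := by
  intro j
  have := hL j
  simp only
  omega

lemma const (z : ℤ) : IsBPath N fun _ => z := fun _ => Or.inl rfl

lemma coe : IsBPath N fun j => ((j : ℕ) : ℤ) := fun j => Or.inr (by simp)

lemma mono (hL : IsBPath N L) : Monotone L :=
  Fin.monotone_iff_le_succ.2 fun j => by have := hL j; omega

lemma monotone_coe_sub (hL : IsBPath N L) : Monotone fun j : Fin (N + 1) => ((j : ℕ) : ℤ) - L j :=
  Fin.monotone_iff_le_succ.2 fun j => by have := hL j; simp; omega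

end IsBPath

/-- Raise a path by up to `m` at sites before `K₀` and after `K`, fixing its values
at `0`, at `N`, and on `[K₀, K]`. -/
def raisePath (m : ℕ) (K₀ K : Fin (N + 1)) (L : Fin (N + 1) → ℤ) (j : Fin (N + 1)) : ℤ :=
  max (min (min ((j : ℕ) : ℤ) (L j + m)) (max (L K₀) (L j)))
    (min (min (max (((j : ℕ) : ℤ) + (L K - (K : ℕ))) (L j)) (L j + m)) (L (Fin.last N)))

/-- Lower a path by `m`, except as needed to keep both endpoints fixed. -/
def lowerPath (m : ℕ) (L : Fin (N + 1) → ℤ) (j : Fin (N + 1)) : ℤ :=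
  max (max (L 0) (L j + -m)) (((j : ℕ) : ℤ) + (L (Fin.last N) - N))

lemma IsBPath.raisePath {L : Fin (N + 1) → ℤ} (hL : IsBPath N L) (m : ℕ) (K₀ K : Fin (N + 1)) :
    IsBPath N (raisePath m K₀ K L) :=
  ((coe.min (hL.add_const _)).min ((const _).max hL)).max
    ((((coe.add_const _).max hL).min (hL.add_const _)).min (const _))

lemma IsBPath.lowerPath {L : Fin (N + 1) → ℤ} (hL : IsBPath N L) (m : ℕ) :
    IsBPath N (lowerPath m L) :=
  ((const _).max (hL.add_const _)).max (coe.add_const _)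

lemma IsBPath.sub_bounds_of_le {L : Fin (N + 1) → ℤ} (hL : IsBPath N L) (i j : Fin (N + 1)) :
    ((i : ℕ) ≤ (j : ℕ) → L i ≤ L j ∧ L j - L i ≤ ((j : ℕ) : ℤ) - (i : ℕ)) := by
  intro hij
  have h1 := hL.mono (Fin.le_def.2 hij)
  have h2 := hL.monotone_coe_sub (Fin.le_def.2 hij)
  simp only at h2
  omega

section Raise

variable {L : Fin (N + 1) → ℤ} {K₀ K : Fin (N + 1)}

lemma le_raisePath (hL : IsBPath N L) (h0 : L 0 = 0) (m : ℕ) (j : Fin (N + 1)) :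
    L j ≤ raisePath m K₀ K L j := by
  have := hL.sub_bounds_of_le 0 j (Nat.zero_le _)
  have := hL.sub_bounds_of_le j (Fin.last N) j.is_le
  simp only [Fin.val_zero, raisePath] at *
  omega

lemma raisePath_eq_self (hL : IsBPath N L) (h0 : L 0 = 0) (m : ℕ) {j : Fin (N + 1)}
    (h1 : K₀ ≤ j) (h2 : j ≤ K) :
    raisePath m K₀ K L j = L j := by
  have := hL.sub_bounds_of_le 0 j (Nat.zero_le _)
  have := hL.sub_bounds_of_le j (Fin.last N) j.is_le
  have := hL.sub_bounds_of_le K₀ j h1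
  have := hL.sub_bounds_of_le j K h2
  simp only [Fin.val_zero, raisePath] at *
  omega

lemma raisePath_zero (hL : IsBPath N L) (h0 : L 0 = 0) (m : ℕ) :
    raisePath m K₀ K L 0 = 0 := by
  have := hL.sub_bounds_of_le 0 K₀ (Nat.zero_le _)
  have := hL.sub_bounds_of_le 0 K (Nat.zero_le _)
  have := hL.sub_bounds_of_le 0 (Fin.last N) (Nat.zero_le _)
  simp only [Fin.val_zero, raisePath] at *
  omega

lemma raisePath_last (hL : IsBPath N L) (h0 : L 0 = 0) (m : ℕ) :
    raisePath m K₀ K L (Fin.last N) = L (Fin.last N) := by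
  have := hL.sub_bounds_of_le K₀ (Fin.last N) K₀.is_le
  have := hL.sub_bounds_of_le K (Fin.last N) K.is_le
  have := hL.sub_bounds_of_le 0 (Fin.last N) (Nat.zero_le _)
  simp only [Fin.val_zero, Fin.val_last, raisePath] at *
  omega

end Raise

lemma lowerPath_le {L : Fin (N + 1) → ℤ} (hL : IsBPath N L) (m : ℕ) (j : Fin (N + 1)) :
    lowerPath m L j ≤ L j := by
  have := hL.sub_bounds_of_le 0 j (Nat.zero_le _)
  have := hL.sub_bounds_of_le j (Fin.last N) j.is_le
  simp only [Fin.val_zero, Fin.val_last, lowerPath] at *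
  omega

lemma lowerPath_zero {L : Fin (N + 1) → ℤ} (hL : IsBPath N L) (m : ℕ) :
    lowerPath m L 0 = L 0 := by
  have := hL.sub_bounds_of_le 0 (Fin.last N) (Nat.zero_le _)
  simp only [Fin.val_zero, Fin.val_last, lowerPath] at *
  omega

lemma lowerPath_last {L : Fin (N + 1) → ℤ} (hL : IsBPath N L) (m : ℕ) :
    lowerPath m L (Fin.last N) = L (Fin.last N) := by
  have := hL.sub_bounds_of_le 0 (Fin.last N) (Nat.zero_le _)
  simp only [Fin.val_zero, Fin.val_last, lowerPath] at *
  omega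

/-- After raising the first layer and lowering the second one, the layers are at distance at
least `m` away from the two ends. -/
lemma le_raisePath_sub_lowerPath {L M : Fin (N + 1) → ℤ} (hL : IsBPath N L)
    (h0 : L 0 = 0) (hML : ∀ j, M j ≤ L j) (m : ℕ) {K₀ K : Fin (N + 1)} (hK : K₀ ≤ K)
    (h1 : (m : ℤ) ≤ L K₀)
    (h2 : (m : ℤ) ≤ ((N : ℤ) - (K : ℕ)) - (L (Fin.last N) - L K))
    {j : Fin (N + 1)} (hj1 : m ≤ (j : ℕ)) (hj2 : (j : ℕ) + m ≤ N) :
    (m : ℤ) ≤ raisePath m K₀ K L j - lowerPath m M j := by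
  have := le_raisePath hL h0 m (K₀ := K₀) (K := K) j
  have := hL.sub_bounds_of_le 0 j (Nat.zero_le _)
  have := hL.sub_bounds_of_le j (Fin.last N) j.is_le
  have := hL.sub_bounds_of_le K₀ j
  have := hL.sub_bounds_of_le K j
  have := hL.sub_bounds_of_le j K₀
  have := hL.sub_bounds_of_le j K
  have := hML 0
  have := hML j
  have := hML (Fin.last N)
  have : (K₀ : ℕ) ≤ K := hK
  simp only [Fin.val_zero, Fin.val_last, raisePath, lowerPath] at *
  omega

/-- The steps at which two paths have different increments. -/
def changeSet (L M : Fin (N + 1) → ℤ) : Finset (Fin N) :=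
  Finset.univ.filter fun j => L j.succ - L j.castSucc ≠ M j.succ - M j.castSucc

lemma mem_changeSet {L M : Fin (N + 1) → ℤ} {j : Fin N} :
    j ∈ changeSet L M ↔ L j.succ - L j.castSucc ≠ M j.succ - M j.castSucc := by
  simp [changeSet]

lemma eq_of_changeSet_eq {L M P : Fin (N + 1) → ℤ} (hL : IsBPath N L) (hM : IsBPath N M)
    (hP : IsBPath N P) (h0 : L 0 = M 0) (h : changeSet L P = changeSet M P) : L = M := by
  refine Fin.eq_of_succ_sub_eq h0 fun j => ?_
  have h1 := Finset.ext_iff.1 h j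
  simp only [mem_changeSet] at h1
  have := hL j
  have := hM j
  have := hP j
  omega

lemma card_changeSet_raisePath_le {L : Fin (N + 1) → ℤ} (hL : IsBPath N L) (h0 : L 0 = 0)
    (m : ℕ) (K₀ K : Fin (N + 1)) : (changeSet L (raisePath m K₀ K L)).card ≤ 4 * m := by
  have b0 := fun j : Fin (N + 1) => hL.sub_bounds_of_le 0 j (Nat.zero_le _)
  have bN := fun j : Fin (N + 1) => hL.sub_bounds_of_le j (Fin.last N) j.is_le
  have e1 := card_ne_succ_le_of_monotone (m := m)
    (f := fun j : Fin (N + 1) => min (((j : ℕ) : ℤ) - L j) m)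
    (fun i j hij => by have := hL.monotone_coe_sub hij; simp only at *; omega)
    (fun j => by have := b0 j; simp only [Fin.val_zero] at *; omega) (fun j => by simp)
  have e2 := card_ne_succ_le_of_antitone (m := m)
    (f := fun j : Fin (N + 1) => min (max (L K₀ - L j) 0) m)
    (fun i j hij => by have := hL.mono hij; simp only at *; omega)
    (fun j => by omega) (fun j => by simp)
  have e3 := card_ne_succ_le_of_monotone (m := m)
    (f := fun j : Fin (N + 1) => min (max ((((j : ℕ) : ℤ) - L j) + (L K - (K : ℕ))) 0) m)
    (fun i j hij => by have := hL.monotone_coe_sub hij; simp only at *; omega)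
    (fun j => by omega) (fun j => by simp)
  have e4 := card_ne_succ_le_of_antitone (m := m)
    (f := fun j : Fin (N + 1) => min (L (Fin.last N) - L j) m)
    (fun i j hij => by have := hL.mono hij; simp only at *; omega)
    (fun j => by have := bN j; omega) (fun j => by simp)
  have key : ∀ j : Fin (N + 1), raisePath m K₀ K L j = L j +
      max (min (min (((j : ℕ) : ℤ) - L j) m) (min (max (L K₀ - L j) 0) m))
        (min (min (max ((((j : ℕ) : ℤ) - L j) + (L K - (K : ℕ))) 0) m)
          (min (L (Fin.last N) - L j) m)) := by
    intro j
    clear e1 e2 e3 e4 b0 bN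
    rw [raisePath, ← max_add_add_left]
    congr 1
    · generalize L j = l
      generalize L K₀ = p
      omega
    · generalize L j = l
      generalize L (Fin.last N) = p
      generalize L K - (K : ℕ) = r
      omega
  refine le_trans (Finset.card_le_card (t := (_ ∪ _) ∪ (_ ∪ _)) ?_)
    ((Finset.card_union_le _ _).trans (((add_le_add ((Finset.card_union_le _ _).trans
      (add_le_add e1 e2)) ((Finset.card_union_le _ _).trans
      (add_le_add e3 e4)))).trans (by omega)))
  intro j
  simp only [mem_changeSet, key, Finset.mem_union, Finset.mem_filter, Finset.mem_univ, true_and]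
  contrapose!
  rintro ⟨⟨g1, g2⟩, g3, g4⟩
  rw [g1, g2, g3, g4]
  ring

lemma card_changeSet_lowerPath_le {L : Fin (N + 1) → ℤ} (hL : IsBPath N L)
    (m : ℕ) : (changeSet L (lowerPath m L)).card ≤ 4 * m := by
  have b0 := fun j : Fin (N + 1) => hL.sub_bounds_of_le 0 j (Nat.zero_le _)
  have bN := fun j : Fin (N + 1) => hL.sub_bounds_of_le j (Fin.last N) j.is_le
  have e1 := card_ne_succ_le_of_monotone (m := m)
    (f := fun j : Fin (N + 1) => min (L j - L 0) m)
    (fun i j hij => by have := hL.mono hij; simp only at *; omega)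
    (fun j => by have := b0 j; omega) (fun j => by simp)
  have e2 := card_ne_succ_le_of_antitone (m := m)
    (f := fun j : Fin (N + 1) => min (N - L (Fin.last N) - (((j : ℕ) : ℤ) - L j)) m)
    (fun i j hij => by have := hL.monotone_coe_sub hij; simp only at *; omega)
    (fun j => by have := bN j; simp only [Fin.val_last] at *; omega) (fun j => by simp)
  refine le_trans (Finset.card_le_card (t := _ ∪ _) ?_)
    ((Finset.card_union_le _ _).trans ((add_le_add e1 e2).trans (by omega)))
  intro j
  simp only [mem_changeSet, lowerPath, Finset.mem_union, Finset.mem_filter, Finset.mem_univ,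
    true_and]
  contrapose!
  rintro ⟨g1, g2⟩
  omega

end BernoulliPaths

lemma card_finset_card_le (N T : ℕ) :
    Fintype.card {S : Finset (Fin N) // S.card ≤ T} ≤ (N + 1) ^ T := by
  have hinj : Function.Injective
      (fun (S : {S : Finset (Fin N) // S.card ≤ T}) (i : Fin T) => S.1.toList[(i : ℕ)]?) := by
    rintro ⟨S, hS⟩ ⟨S', hS'⟩ h
    have : S.toList = S'.toList := by
      refine List.ext_getElem? fun i => ?_
      by_cases hi : i < T
      · exact congrFun h ⟨i, hi⟩
      · rw [List.getElem?_eq_none, List.getElem?_eq_none] <;> rw [Finset.length_toList] <;> omega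
    simpa using congrArg List.toFinset this
  simpa using Fintype.card_le_of_injective _ hinj

section Height

variable {N : ℕ}

lemma heightTL_congr {L M : Fin (N + 1) → ℤ} {t : ℝ} {K₀ K : Fin (N + 1)} (hK : K₀ ≤ K)
    (h0 : M 0 = L 0) (heq : ∀ j, K₀ ≤ j → j ≤ K → M j = L j)
    (h1 : ((K₀ : ℕ) : ℝ) ≤ N * t) (h2 : (N : ℝ) * t ≤ (K : ℕ)) :
    heightTL N M t = heightTL N L t := by
  have key := Fin.sum_succ_sub_castSucc (N := N)
    (fun j => if j ≤ K₀ then ((M j : ℝ) - L j) else 0)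
  have hlast : (if Fin.last N ≤ K₀ then ((M (Fin.last N) : ℝ) - L (Fin.last N)) else 0) = 0 := by
    split_ifs with h
    · have e : Fin.last N = K₀ := le_antisymm h (Fin.le_last _)
      rw [e, heq K₀ le_rfl hK, sub_self]
    · rfl
  simp only [Fin.zero_le, if_true, hlast, h0, sub_self] at key
  have hsum : ∑ k : Fin N, ((M k.succ - M k.castSucc : ℤ) : ℝ) *
        min 1 (max 0 ((N : ℝ) * t - (k : ℕ)))
      - ∑ k : Fin N, ((L k.succ - L k.castSucc : ℤ) : ℝ) * min 1 (max 0 ((N : ℝ) * t - (k : ℕ)))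
      = 0 := by
    rw [← Finset.sum_sub_distrib]
    refine Eq.trans ?_ key
    refine Finset.sum_congr rfl fun k _ => ?_
    push_cast
    by_cases hk : k.succ ≤ K₀
    · have hk' : k.castSucc ≤ K₀ := k.castSucc_lt_succ.le.trans hk
      have hk2 : ((k : ℕ) : ℝ) + 1 ≤ (K₀ : ℕ) := by
        have : (k : ℕ) + 1 ≤ K₀ := by simpa using Fin.le_def.1 hk
        exact_mod_cast this
      rw [if_pos hk, if_pos hk', min_eq_left (le_max_of_le_right (by linarith))]
      ring
    · have hk' : K₀ ≤ k.castSucc := by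
        rw [Fin.le_def] at hk ⊢
        simp at hk ⊢
        omega
      have hz : (if k.castSucc ≤ K₀ then ((M k.castSucc : ℝ) - L k.castSucc) else 0) = 0 := by
        split_ifs with h
        · have e : k.castSucc = K₀ := le_antisymm h hk'
          rw [e, heq K₀ le_rfl hK, sub_self]
        · rfl
      rw [if_neg hk, hz, sub_self]
      by_cases hkK : k.succ ≤ K
      · rw [heq _ (hk'.trans k.castSucc_lt_succ.le) hkK,
          heq _ hk' (k.castSucc_lt_succ.le.trans hkK)]
        ring
      · have hk2 : ((K : ℕ) : ℝ) ≤ (k : ℕ) := by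
          have : (K : ℕ) ≤ k := by
            rw [Fin.le_def] at hkK
            simp at hkK
            omega
          exact_mod_cast this
        rw [max_eq_left (by linarith)]
        simp
  rw [heightTL, heightTL, h0, sub_eq_zero.1 hsum]

lemma heightTL_one (L : Fin (N + 1) → ℤ) : heightTL N L 1 = (N : ℝ)⁻¹ * L (Fin.last N) := by
  have key := Fin.sum_succ_sub_castSucc (N := N) (fun j => (L j : ℝ))
  rw [heightTL]
  congr 1
  rw [← eq_sub_iff_add_eq', ← key]
  refine Finset.sum_congr rfl fun k _ => ?_
  have : ((k : ℕ) : ℝ) + 1 ≤ N := by exact_mod_cast k.isLt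
  rw [min_eq_left (le_max_of_le_right (by linarith))]
  push_cast
  ring

lemma heightTL_le {L : Fin (N + 1) → ℤ} (hL : IsBPath N L) {t : ℝ} {i : Fin (N + 1)}
    (ht : (N : ℝ) * t ≤ (i : ℕ)) : heightTL N L t ≤ (N : ℝ)⁻¹ * L i := by
  have key := Fin.sum_succ_sub_castSucc (N := N) (fun j => (L (min j i) : ℝ))
  simp only [min_eq_right (Fin.le_last i), min_eq_left (Fin.zero_le i)] at key
  rw [heightTL]
  refine mul_le_mul_of_nonneg_left ?_ (by positivity)
  rw [← le_sub_iff_add_le', ← key]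
  refine Finset.sum_le_sum fun k _ => ?_
  push_cast
  by_cases hk : k.succ ≤ i
  · rw [min_eq_left hk, min_eq_left (k.castSucc_lt_succ.le.trans hk)]
    have : (L k.castSucc : ℝ) ≤ L k.succ := by exact_mod_cast hL.mono k.castSucc_lt_succ.le
    exact mul_le_of_le_one_right (by linarith) (min_le_left _ _)
  · have hk' : i ≤ k.castSucc := by
      rw [Fin.le_def] at hk ⊢
      simp at hk ⊢
      omega
    have hk2 : ((i : ℕ) : ℝ) ≤ (k : ℕ) := by exact_mod_cast Fin.le_def.1 hk'
    rw [min_eq_right hk', min_eq_right (hk'.trans k.castSucc_lt_succ.le),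
      max_eq_left (by linarith)]
    simp

end Height

section Weights

lemma qPoch_pos {z q : ℝ} (hz : z < 1) (hz0 : 0 ≤ z) (hq0 : 0 ≤ q) (hq1 : q < 1) (n : ℕ) :
    0 < qPoch z q n :=
  Finset.prod_pos fun j _ => by
    have := mul_le_of_le_one_right hz0 (pow_le_one₀ hq0 hq1.le (n := j))
    linarith

lemma qPoch_le_one {z q : ℝ} (hz : z < 1) (hz0 : 0 ≤ z) (hq0 : 0 ≤ q) (hq1 : q < 1) (n : ℕ) :
    qPoch z q n ≤ 1 := by
  refine Finset.prod_le_one (fun j _ => ?_) (fun j _ => ?_)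
  · have := mul_le_of_le_one_right hz0 (pow_le_one₀ hq0 hq1.le (n := j))
    linarith
  · have : 0 ≤ z * q ^ j := by positivity
    linarith

lemma exp_le_qPoch {z q : ℝ} (hz : z < 1) (hz0 : 0 ≤ z) (hq0 : 0 ≤ q) (hq1 : q < 1) (n : ℕ) :
    Real.exp (-(z / (1 - z) * (1 - q)⁻¹)) ≤ qPoch z q n := by
  have hz' : 0 < 1 - z := by linarith
  have h1 : ∑ j ∈ Finset.range n, z / (1 - z) * q ^ j ≤ z / (1 - z) * (1 - q)⁻¹ := by
    rw [← Finset.mul_sum, ← tsum_geometric_of_lt_one hq0 hq1]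
    exact mul_le_mul_of_nonneg_left
      ((summable_geometric_of_lt_one hq0 hq1).sum_le_tsum _ fun _ _ => by positivity)
      (by positivity)
  refine (Real.exp_le_exp.2 (neg_le_neg h1)).trans ?_
  rw [← Finset.sum_neg_distrib, Real.exp_sum]
  refine Finset.prod_le_prod (fun j _ => (Real.exp_pos _).le) fun j _ => ?_
  have hle := mul_le_of_le_one_right hz0 (pow_le_one₀ hq0 hq1.le (n := j))
  have hx0 : 0 ≤ z * q ^ j := by positivity
  have hx : 0 < 1 - z * q ^ j := by linarith
  have h2 : z * q ^ j / (1 - z * q ^ j) ≤ z / (1 - z) * q ^ j := by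
    rw [div_mul_eq_mul_div]
    exact div_le_div_of_nonneg_left hx0 hz' (by linarith)
  have h3 : (1 - z * q ^ j)⁻¹ ≤ Real.exp (z / (1 - z) * q ^ j) := by
    refine le_trans ?_ (Real.add_one_le_exp _)
    have : (1 - z * q ^ j)⁻¹ = z * q ^ j / (1 - z * q ^ j) + 1 := by field_simp; ring
    linarith
  rw [Real.exp_neg]
  exact inv_le_of_inv_le₀ hx h3

variable {q c d : ℝ}

lemma mul_mem_Ico_of_neg_one_lt (hc1 : -1 < c) (hc2 : c ≤ 0) (hd1 : -1 < d) (hd2 : d ≤ 0)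
    : c * d ∈ Set.Ico (0 : ℝ) 1 :=
  ⟨mul_nonneg_of_nonpos_of_nonpos hc2 hd2, by nlinarith⟩

lemma Wfac_le_one (hc1 : -1 < c) (hc2 : c ≤ 0) (hd1 : -1 < d) (hd2 : d ≤ 0)
    (hq0 : 0 ≤ q)
    (x u v : ℤ) : Wfac q c d x u v ≤ 1 := by
  have hcd := mul_mem_Ico_of_neg_one_lt hc1 hc2 hd1 hd2
  have hp : 0 ≤ q ^ x.toNat := by positivity
  have h1 := mul_nonneg hcd.1 hp
  have h2 := mul_nonneg (neg_nonneg.2 hc2) hp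
  have h3 := mul_nonneg (neg_nonneg.2 hd2) hp
  rw [Wfac]
  split_ifs <;> linarith

lemma one_sub_pow_le_Wfac (hc1 : -1 < c) (hc2 : c ≤ 0) (hd1 : -1 < d) (hd2 : d ≤ 0)
    (hq0 : 0 ≤ q) (hq1 : q < 1)
    {m : ℕ} {x : ℤ} (hx : (m : ℤ) ≤ x) (u v : ℤ) :
    1 - q ^ m ≤ Wfac q c d x u v := by
  have hcd := mul_mem_Ico_of_neg_one_lt hc1 hc2 hd1 hd2
  have hp : 0 ≤ q ^ x.toNat := by positivity
  have hm : q ^ x.toNat ≤ q ^ m := pow_le_pow_of_le_one hq0 hq1.le (by omega)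
  have h1 := mul_le_mul_of_nonneg_right hcd.2.le hp
  have h2 := mul_le_mul_of_nonneg_right hc1.le hp
  have h3 := mul_le_mul_of_nonneg_right hd1.le hp
  rw [Wfac]
  split_ifs <;> linarith

lemma const_le_Wfac (hc1 : -1 < c) (hc2 : c ≤ 0) (hd1 : -1 < d) (hd2 : d ≤ 0)
    (hq0 : 0 ≤ q) (hq1 : q < 1)
    {x u v : ℤ} (h : u = 1 ∧ v = 0 → 1 ≤ x) :
    (1 - q) * (1 + c) * (1 + d) ≤ Wfac q c d x u v := by
  have hcd := mul_mem_Ico_of_neg_one_lt hc1 hc2 hd1 hd2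
  have hp : 0 ≤ q ^ x.toNat := by positivity
  have hp1 : q ^ x.toNat ≤ 1 := pow_le_one₀ hq0 hq1.le
  have e1 : (1 - q) * (1 + c) ≤ 1 - q := mul_le_of_le_one_right (by linarith) (by linarith)
  have e1' : (1 - q) * (1 + c) ≤ 1 + c := mul_le_of_le_one_left (by linarith) (by linarith)
  have e0 : 0 ≤ (1 - q) * (1 + c) := mul_nonneg (by linarith) (by linarith)
  have e2 := mul_le_of_le_one_right e0 (show 1 + d ≤ 1 by linarith)
  have e3 := mul_le_of_le_one_left (show 0 ≤ 1 + d by linarith)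
    (show (1 - q) * (1 + c) ≤ 1 by linarith)
  have h1 := mul_le_of_le_one_right hcd.1 hp1
  have h2 := mul_le_of_le_one_right (neg_nonneg.2 hc2) hp1
  have h3 := mul_le_of_le_one_right (neg_nonneg.2 hd2) hp1
  have h4 : c * d ≤ -c := by nlinarith
  rw [Wfac]
  split_ifs with hu
  · have : q ^ x.toNat ≤ q ^ 1 :=
      pow_le_pow_of_le_one hq0 hq1.le (by have := h hu; omega)
    linarith
  all_goals linarith

variable {N : ℕ} {a b : ℝ}

lemma twt0_nonneg (ha : 0 ≤ a) (hb : 0 ≤ b)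
    (p : (Fin (N + 1) → ℤ) × (Fin (N + 1) → ℤ)) : 0 ≤ twt0 N a b p := by
  rw [twt0]; positivity

lemma one_le_gap_of_step {p : (Fin (N + 1) → ℤ) × (Fin (N + 1) → ℤ)} (hp : p ∈ TLset N)
    (j : Fin N) (h : p.1 j.succ - p.1 j.castSucc = 1 ∧ p.2 j.succ - p.2 j.castSucc = 0) :
    1 ≤ p.1 j.succ - p.2 j.succ := by
  have := hp.2.1 j.castSucc
  omega

lemma twt_nonneg (hc1 : -1 < c) (hc2 : c ≤ 0) (hd1 : -1 < d) (hd2 : d ≤ 0)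
    (hq0 : 0 ≤ q) (hq1 : q < 1) (ha : 0 ≤ a) (hb : 0 ≤ b)
    {p : (Fin (N + 1) → ℤ) × (Fin (N + 1) → ℤ)} (hp : p ∈ TLset N) :
    0 ≤ twt N q a b c d p := by
  have hcd := mul_mem_Ico_of_neg_one_lt hc1 hc2 hd1 hd2
  have h1 := (qPoch_pos hcd.2 hcd.1 hq0 hq1
    (p.1 (Fin.last N) - p.2 (Fin.last N)).toNat).le
  have h2 := (qPoch_pos hq1 hq0 hq0 hq1 (p.1 (Fin.last N) - p.2 (Fin.last N)).toNat).le
  have h3 : 0 ≤ (1 - q) * (1 + c) * (1 + d) :=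
    mul_nonneg (mul_nonneg (by linarith) (by linarith)) (by linarith)
  have h4 : 0 ≤ ∏ j : Fin N, Wfac q c d (p.1 j.succ - p.2 j.succ)
      (p.1 j.succ - p.1 j.castSucc) (p.2 j.succ - p.2 j.castSucc) :=
    Finset.prod_nonneg fun j _ => h3.trans
      (const_le_Wfac hc1 hc2 hd1 hd2 hq0 hq1 (one_le_gap_of_step hp j))
  rw [twt]
  positivity

lemma twt_le_mul_twt0 (hc1 : -1 < c) (hc2 : c ≤ 0) (hd1 : -1 < d) (hd2 : d ≤ 0)
    (hq0 : 0 ≤ q) (hq1 : q < 1) (ha : 0 ≤ a) (hb : 0 ≤ b)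
    {p : (Fin (N + 1) → ℤ) × (Fin (N + 1) → ℤ)} (hp : p ∈ TLset N) :
    twt N q a b c d p ≤ Real.exp (q / (1 - q) * (1 - q)⁻¹) * twt0 N a b p := by
  have hcd := mul_mem_Ico_of_neg_one_lt hc1 hc2 hd1 hd2
  have h0 := twt0_nonneg ha hb p
  set n := (p.1 (Fin.last N) - p.2 (Fin.last N)).toNat with hn
  have h2 := qPoch_pos hq1 hq0 hq0 hq1 n
  have h3 : 0 ≤ (1 - q) * (1 + c) * (1 + d) :=
    mul_nonneg (mul_nonneg (by linarith) (by linarith)) (by linarith)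
  have h4 : ∏ j : Fin N, Wfac q c d (p.1 j.succ - p.2 j.succ)
      (p.1 j.succ - p.1 j.castSucc) (p.2 j.succ - p.2 j.castSucc) ≤ 1 :=
    Finset.prod_le_one (fun j _ => h3.trans
      (const_le_Wfac hc1 hc2 hd1 hd2 hq0 hq1 (one_le_gap_of_step hp j)))
      (fun j _ => Wfac_le_one hc1 hc2 hd1 hd2 hq0 _ _ _)
  have h5 : qPoch (c * d) q n / qPoch q q n ≤ Real.exp (q / (1 - q) * (1 - q)⁻¹) := by
    rw [div_le_iff₀ h2]
    refine (qPoch_le_one hcd.2 hcd.1 hq0 hq1 n).trans ?_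
    have := mul_le_mul_of_nonneg_left (exp_le_qPoch hq1 hq0 hq0 hq1 n)
      (Real.exp_pos (q / (1 - q) * (1 - q)⁻¹)).le
    rwa [← Real.exp_add, add_neg_cancel, Real.exp_zero] at this
  have h6 : 0 ≤ qPoch (c * d) q n / qPoch q q n :=
    div_nonneg (qPoch_pos hcd.2 hcd.1 hq0 hq1 n).le h2.le
  have e : twt N q a b c d p = twt0 N a b p * (qPoch (c * d) q n / qPoch q q n) *
    ∏ j : Fin N, Wfac q c d (p.1 j.succ - p.2 j.succ)
      (p.1 j.succ - p.1 j.castSucc) (p.2 j.succ - p.2 j.castSucc) := rfl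
  rw [e, mul_comm (Real.exp _)]
  exact (mul_le_of_le_one_right (mul_nonneg h0 h6) h4).trans (mul_le_mul_of_nonneg_left h5 h0)

/-- If the two layers are at distance at least `m` away from the ends, the weights are
comparable. -/
lemma mul_twt0_le_twt (hc1 : -1 < c) (hc2 : c ≤ 0) (hd1 : -1 < d) (hd2 : d ≤ 0)
    (hq0 : 0 ≤ q) (hq1 : q < 1) (ha : 0 ≤ a) (hb : 0 ≤ b)
    {p : (Fin (N + 1) → ℤ) × (Fin (N + 1) → ℤ)} (hp : p ∈ TLset N) {m : ℕ}
    (hgap : ∀ j : Fin (N + 1), m ≤ (j : ℕ) → (j : ℕ) + m ≤ N → (m : ℤ) ≤ p.1 j - p.2 j) :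
    Real.exp (-(c * d / (1 - c * d) * (1 - q)⁻¹)) *
      (((1 - q) * (1 + c) * (1 + d)) ^ (2 * m) * (1 - q ^ m) ^ N) * twt0 N a b p
      ≤ twt N q a b c d p := by
  have hcd := mul_mem_Ico_of_neg_one_lt hc1 hc2 hd1 hd2
  have h0 := twt0_nonneg ha hb p
  set n := (p.1 (Fin.last N) - p.2 (Fin.last N)).toNat with hn
  set δ := (1 - q) * (1 + c) * (1 + d) with hδ
  have hδ0 : 0 ≤ δ := mul_nonneg (mul_nonneg (by linarith) (by linarith)) (by linarith)
  have hδ1 : δ ≤ 1 := mul_le_one₀ (mul_le_one₀ (by linarith) (by linarith) (by linarith))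
    (by linarith) (by linarith)
  have hqm0 : 0 ≤ q ^ m := by positivity
  have hqm1 : 0 ≤ 1 - q ^ m := sub_nonneg.2 (pow_le_one₀ hq0 hq1.le)
  have h5 : Real.exp (-(c * d / (1 - c * d) * (1 - q)⁻¹)) ≤ qPoch (c * d) q n / qPoch q q n := by
    rw [le_div_iff₀ (qPoch_pos hq1 hq0 hq0 hq1 n)]
    exact (mul_le_of_le_one_right (Real.exp_pos _).le (qPoch_le_one hq1 hq0 hq0 hq1 n)).trans
      (exp_le_qPoch hcd.2 hcd.1 hq0 hq1 n)
  let S : Finset (Fin N) := Finset.univ.filter fun j => (j : ℕ) + 1 < m ∨ N < (j : ℕ) + 1 + m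
  have hS : S.card ≤ 2 * m := by
    rw [two_mul]
    refine (Finset.card_le_card (Finset.filter_or _ _ _).subset).trans
      ((Finset.card_union_le _ _).trans (add_le_add ?_ ?_))
    · conv_rhs => rw [← Finset.card_range m]
      refine Finset.card_le_card_of_injOn (fun j => (j : ℕ)) ?_ ?_
      · intro j hj
        simp at hj ⊢
        omega
      · intro i _ j _ hij
        exact Fin.ext hij
    · conv_rhs => rw [← Finset.card_range m]
      refine Finset.card_le_card_of_injOn (fun j => N - 1 - (j : ℕ)) ?_ ?_
      · intro j hj
        simp at hj ⊢
        omega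
      · intro i _ j _ hij
        have := i.isLt
        have := j.isLt
        simp only at hij
        exact Fin.ext (by omega)
  have h4 : δ ^ (2 * m) * (1 - q ^ m) ^ N ≤ ∏ j : Fin N, Wfac q c d (p.1 j.succ - p.2 j.succ)
      (p.1 j.succ - p.1 j.castSucc) (p.2 j.succ - p.2 j.castSucc) := by
    calc δ ^ (2 * m) * (1 - q ^ m) ^ N ≤ δ ^ S.card * (1 - q ^ m) ^ N :=
          mul_le_mul_of_nonneg_right (pow_le_pow_of_le_one hδ0 hδ1 hS) (by positivity)
      _ = ∏ j : Fin N, (if j ∈ S then δ else 1) * (1 - q ^ m) := by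
          rw [Finset.prod_mul_distrib, Finset.prod_ite_mem, Finset.univ_inter,
            Finset.prod_const, Finset.prod_const, Finset.card_univ, Fintype.card_fin]
      _ ≤ _ := by
          refine Finset.prod_le_prod (fun j _ => ?_) fun j _ => ?_
          · split_ifs <;> positivity
          · split_ifs with hj
            · exact (mul_le_of_le_one_right hδ0 (by linarith)).trans
                (const_le_Wfac hc1 hc2 hd1 hd2 hq0 hq1 (one_le_gap_of_step hp j))
            · rw [one_mul]
              simp only [S, Finset.mem_filter, Finset.mem_univ, true_and] at hj
              refine one_sub_pow_le_Wfac hc1 hc2 hd1 hd2 hq0 hq1 (hgap _ ?_ ?_) _ _ <;>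
                simp only [Fin.val_succ] <;> omega
  have e : twt N q a b c d p = twt0 N a b p * (qPoch (c * d) q n / qPoch q q n) *
    ∏ j : Fin N, Wfac q c d (p.1 j.succ - p.2 j.succ)
      (p.1 j.succ - p.1 j.castSucc) (p.2 j.succ - p.2 j.castSucc) := rfl
  rw [e, mul_comm _ (twt0 N a b p), ← mul_assoc]
  exact mul_le_mul (mul_le_mul_of_nonneg_left h5 h0) h4 (by positivity)
    (mul_nonneg h0 ((Real.exp_pos _).le.trans h5))

end Weights

section Partition

variable {N : ℕ} {a b : ℝ}

lemma pow_mul_pow_le_of_dist_le (ha : 0 ≤ a) (hb : 0 ≤ b) (hab : a * b < 1) {n e : ℕ}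
    (h1 : n ≤ e + N) (h2 : e ≤ n + N) :
    a ^ n * b ^ e ≤ (max 1 a ^ N * max 1 b ^ N) * (a * b) ^ (n - N) := by
  have hA : ∀ {x : ℝ} {i : ℕ}, 0 ≤ x → i ≤ N → x ^ i ≤ max 1 x ^ N := fun hx hi =>
    (pow_le_pow_left₀ hx (le_max_right _ _) _).trans (pow_le_pow_right₀ (le_max_left _ _) hi)
  obtain ⟨s, hs⟩ : ∃ s, s = min n e := ⟨_, rfl⟩
  obtain ⟨i, rfl⟩ : ∃ i, n = s + i := ⟨n - s, by omega⟩
  obtain ⟨i', rfl⟩ : ∃ i', e = s + i' := ⟨e - s, by omega⟩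
  have e1 : a ^ (s + i) * b ^ (s + i') = (a ^ i * b ^ i') * (a * b) ^ s := by
    rw [pow_add, pow_add, mul_pow]; ring
  rw [e1]
  exact mul_le_mul (mul_le_mul (hA ha (by omega)) (hA hb (by omega)) (by positivity)
    (by positivity)) (pow_le_pow_of_le_one (by positivity) hab.le (by omega)) (by positivity)
    (by positivity)

lemma summable_twt0 (ha : 0 ≤ a) (hb : 0 ≤ b) (hab : a * b < 1) :
    Summable fun p : TLset N => twt0 N a b p.1 := by
  let Z : Fin (N + 1) → ℤ := fun _ => 0
  let Ψ : TLset N → ℕ × (Finset (Fin N) × Finset (Fin N)) := fun p =>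
    ((p.1.1 0 - p.1.2 0).toNat, changeSet p.1.1 Z, changeSet p.1.2 Z)
  have hΨ : Function.Injective Ψ := by
    rintro ⟨⟨L, M⟩, hL0, hML, hL, hM⟩ ⟨⟨L', M'⟩, hL0', hML', hL', hM'⟩ h
    simp only [Ψ, Prod.mk.injEq] at h
    simp only at hL0 hML hL hM hL0' hML' hL' hM'
    have := hML 0
    have := hML' 0
    have e1 := eq_of_changeSet_eq hL hL' (IsBPath.const 0) (by omega) h.2.1
    have e2 := eq_of_changeSet_eq hM hM' (IsBPath.const 0) (by omega) h.2.2
    subst e1 e2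
    rfl
  have hgeo : Summable fun n : ℕ => (max 1 a ^ N * max 1 b ^ N) * (a * b) ^ (n - N) := by
    refine Summable.mul_left _ ((summable_nat_add_iff N).1 ?_)
    simpa using summable_geometric_of_lt_one (mul_nonneg ha hb) hab
  have hprod : Summable fun x : ℕ × (Finset (Fin N) × Finset (Fin N)) =>
      ((max 1 a ^ N * max 1 b ^ N) * (a * b) ^ (x.1 - N)) * (fun _ => (1 : ℝ)) x.2 :=
    hgeo.mul_of_nonneg (Summable.of_finite)
      (fun n => by have := mul_nonneg ha hb; positivity) (fun _ => zero_le_one)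
  refine Summable.of_nonneg_of_le (fun p => twt0_nonneg ha hb p.1) (fun p => ?_)
    (hprod.comp_injective hΨ)
  obtain ⟨⟨L, M⟩, hL0, hML, hL, hM⟩ := p
  simp only at hL0 hML hL hM
  have := hML 0
  have := hML (Fin.last N)
  have b1 := hL.sub_bounds_of_le 0 (Fin.last N) (Nat.zero_le _)
  have b2 := hM.sub_bounds_of_le 0 (Fin.last N) (Nat.zero_le _)
  simp only [Fin.val_zero, Fin.val_last] at b1 b2
  simp only [twt0, Function.comp, Ψ, mul_one]
  exact pow_mul_pow_le_of_dist_le ha hb hab (by omega) (by omega)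

variable {q c d : ℝ}

lemma summable_twt (hc1 : -1 < c) (hc2 : c ≤ 0) (hd1 : -1 < d) (hd2 : d ≤ 0)
    (hq0 : 0 ≤ q) (hq1 : q < 1) (ha : 0 ≤ a) (hb : 0 ≤ b) (hab : a * b < 1) :
    Summable fun p : TLset N => twt N q a b c d p.1 :=
  Summable.of_nonneg_of_le (fun p => twt_nonneg hc1 hc2 hd1 hd2 hq0 hq1 ha hb p.2)
    (fun p => twt_le_mul_twt0 hc1 hc2 hd1 hd2 hq0 hq1 ha hb p.2)
    ((summable_twt0 ha hb hab).mul_left _)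

lemma Summable.indicator_coe {α : Type*} {s : Set α} {f : α → ℝ}
    (hf : Summable fun p : s => f p) (V : Set α) :
    Summable fun p : s => V.indicator f p.1 := by
  have : (fun p : s => V.indicator f p.1) =
      (Subtype.val ⁻¹' V : Set s).indicator (fun p : s => f p) := by
    ext p
    exact (Set.indicator_comp_right Subtype.val).symm
  rw [this]
  exact hf.indicator _

/-- Upper bound for the restricted partition function. -/
lemma tsum_twt_le (hc1 : -1 < c) (hc2 : c ≤ 0) (hd1 : -1 < d) (hd2 : d ≤ 0)
    (hq0 : 0 ≤ q) (hq1 : q < 1) (ha : 0 ≤ a) (hb : 0 ≤ b) (hab : a * b < 1)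
    (V : Set ((Fin (N + 1) → ℤ) × (Fin (N + 1) → ℤ))) :
    ∑' p : TLset N, V.indicator (twt N q a b c d) p.1 ≤
      Real.exp (q / (1 - q) * (1 - q)⁻¹) * ∑' p : TLset N, V.indicator (twt0 N a b) p.1 := by
  rw [← tsum_mul_left]
  refine Summable.tsum_le_tsum (fun p => ?_)
    ((summable_twt hc1 hc2 hd1 hd2 hq0 hq1 ha hb hab).indicator_coe V)
    (((summable_twt0 ha hb hab).indicator_coe V).mul_left _)
  by_cases hp : p.1 ∈ V
  · simpa [hp] using twt_le_mul_twt0 hc1 hc2 hd1 hd2 hq0 hq1 ha hb p.2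
  · simp [hp]

/-- Lower bound for the restricted partition function, by raising the first layer and lowering
the second one. -/
lemma mul_tsum_twt0_le (hc1 : -1 < c) (hc2 : c ≤ 0) (hd1 : -1 < d) (hd2 : d ≤ 0)
    (hq0 : 0 ≤ q) (hq1 : q < 1) (ha : 0 ≤ a) (hb : 0 ≤ b) (hab : a * b < 1)
    (V : Set ((Fin (N + 1) → ℤ) × (Fin (N + 1) → ℤ))) (m : ℕ) {K₀ K : Fin (N + 1)} (hK : K₀ ≤ K)
    (hV : ∀ p ∈ TLset N, p ∈ V → (m : ℤ) ≤ p.1 K₀ ∧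
      (m : ℤ) ≤ ((N : ℤ) - (K : ℕ)) - (p.1 (Fin.last N) - p.1 K) ∧
      (raisePath m K₀ K p.1, lowerPath m p.2) ∈ V) :
    Real.exp (-(c * d / (1 - c * d) * (1 - q)⁻¹)) *
      (((1 - q) * (1 + c) * (1 + d)) ^ (2 * m) * (1 - q ^ m) ^ N) *
      ∑' p : TLset N, V.indicator (twt0 N a b) p.1 ≤
    ((N + 1) ^ (4 * m)) ^ 2 * ∑' p : TLset N, V.indicator (twt N q a b c d) p.1 := by
  set C := Real.exp (-(c * d / (1 - c * d) * (1 - q)⁻¹)) *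
      (((1 - q) * (1 + c) * (1 + d)) ^ (2 * m) * (1 - q ^ m) ^ N) with hC
  let T := {S : Finset (Fin N) // S.card ≤ 4 * m}
  let Φ : TLset N → TLset N × (T × T) := fun p =>
    (⟨(raisePath m K₀ K p.1.1, lowerPath m p.1.2),
      raisePath_zero p.2.2.2.1 p.2.1 m,
      fun j => (lowerPath_le p.2.2.2.2 m j).trans
        ((p.2.2.1 j).trans (le_raisePath p.2.2.2.1 p.2.1 m j)),
      p.2.2.2.1.raisePath m K₀ K, p.2.2.2.2.lowerPath m⟩,
     ⟨changeSet p.1.1 (raisePath m K₀ K p.1.1),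
       card_changeSet_raisePath_le p.2.2.2.1 p.2.1 m K₀ K⟩,
     ⟨changeSet p.1.2 (lowerPath m p.1.2), card_changeSet_lowerPath_le p.2.2.2.2 m⟩)
  have hΦ : Function.Injective Φ := by
    rintro ⟨⟨L, M⟩, hL0, hML, hL, hM⟩ ⟨⟨L', M'⟩, hL0', hML', hL', hM'⟩ h
    simp only at hL0 hML hL hM hL0' hML' hL' hM'
    have h1 : raisePath m K₀ K L = raisePath m K₀ K L' := congrArg (fun x => x.1.1.1) h
    have h2 : lowerPath m M = lowerPath m M' := congrArg (fun x => x.1.1.2) h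
    have h3 : changeSet L (raisePath m K₀ K L) = changeSet L' (raisePath m K₀ K L') :=
      congrArg (fun x => x.2.1.1) h
    have h4 : changeSet M (lowerPath m M) = changeSet M' (lowerPath m M') :=
      congrArg (fun x => x.2.2.1) h
    rw [← h1] at h3
    rw [← h2] at h4
    have e1 := eq_of_changeSet_eq hL hL' (hL.raisePath m K₀ K) (hL0.trans hL0'.symm) h3
    have h00 := congrFun h2 0
    rw [lowerPath_zero hM, lowerPath_zero hM'] at h00
    have e2 := eq_of_changeSet_eq hM hM' (hM.lowerPath m) h00 h4
    subst e1 e2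
    rfl
  have hsum := (summable_twt (N := N) hc1 hc2 hd1 hd2 hq0 hq1 ha hb hab).indicator_coe V
  have hnn : ∀ p : TLset N, 0 ≤ V.indicator (twt N q a b c d) p.1 := fun p =>
    Set.indicator_apply_nonneg fun _ => twt_nonneg hc1 hc2 hd1 hd2 hq0 hq1 ha hb p.2
  have hone : Summable fun _ : T × T => (1 : ℝ) := Summable.of_finite
  have hprod : Summable fun x : TLset N × (T × T) =>
      V.indicator (twt N q a b c d) x.1.1 * (fun _ => (1 : ℝ)) x.2 :=
    hsum.mul_of_nonneg hone hnn (fun _ => zero_le_one)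
  rw [← tsum_mul_left]
  refine (Summable.tsum_le_tsum_of_inj Φ hΦ
    (fun x _ => mul_nonneg (hnn x.1) zero_le_one) (fun p => ?_)
    (((summable_twt0 ha hb hab).indicator_coe V).mul_left _) hprod).trans ?_
  · by_cases hp : p.1 ∈ V
    · obtain ⟨h1, h2, h3⟩ := hV p.1 p.2 hp
      have h4 := mul_twt0_le_twt hc1 hc2 hd1 hd2 hq0 hq1 ha hb (Φ p).1.2 (m := m) fun j hj1 hj2 =>
        le_raisePath_sub_lowerPath p.2.2.2.1 p.2.1 p.2.2.1 m hK h1 h2 hj1 hj2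
      have h5 : twt0 N a b (Φ p).1.1 = twt0 N a b p.1 := by
        simp only [twt0, Φ]
        rw [raisePath_zero p.2.2.2.1 p.2.1, raisePath_last p.2.2.2.1 p.2.1,
          lowerPath_zero p.2.2.2.2, lowerPath_last p.2.2.2.2, p.2.1]
      rw [h5] at h4
      have h3' : (Φ p).1.1 ∈ V := h3
      simpa [hp, h3'] using h4
    · rw [Set.indicator_of_notMem hp, mul_zero]
      exact mul_nonneg (hnn _) zero_le_one
  · rw [← hsum.tsum_mul_tsum hone hprod, mul_comm]
    refine mul_le_mul_of_nonneg_right ?_ (tsum_nonneg hnn)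
    rw [tsum_const, Nat.card_eq_fintype_card, Fintype.card_prod, nsmul_eq_mul, mul_one, sq]
    exact_mod_cast Nat.mul_le_mul (card_finset_card_le N (4 * m)) (card_finset_card_le N (4 * m))

end Partition

section Limit

open Filter Topology

lemma Nat.tendsto_sqrt_atTop : Tendsto Nat.sqrt atTop atTop :=
  tendsto_atTop.2 fun b => (eventually_ge_atTop (b * b)).mono fun _ hn => Nat.le_sqrt.2 hn

lemma tendsto_sqrt_div : Tendsto (fun N : ℕ => (N : ℝ)⁻¹ * (Nat.sqrt N : ℝ)) atTop (𝓝 0) := by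
  have h1 : Tendsto (fun N : ℕ => ((Nat.sqrt N : ℕ) : ℝ)⁻¹) atTop (𝓝 0) :=
    tendsto_inv_atTop_zero.comp (tendsto_natCast_atTop_atTop.comp Nat.tendsto_sqrt_atTop)
  refine squeeze_zero' (Eventually.of_forall fun N => by positivity) ?_ h1
  filter_upwards [eventually_ge_atTop 1] with N hN
  have hm : 0 < Nat.sqrt N := Nat.sqrt_pos.2 hN
  have hm' : (0 : ℝ) < Nat.sqrt N := by exact_mod_cast hm
  have hN' : (0 : ℝ) < N := by exact_mod_cast hN
  have h : (Nat.sqrt N : ℝ) * Nat.sqrt N ≤ N := by exact_mod_cast Nat.sqrt_le N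
  rw [inv_mul_le_iff₀ hN', ← div_eq_mul_inv, le_div_iff₀ hm']
  exact h

lemma tendsto_sqrt_mul_log_div :
    Tendsto (fun N : ℕ => (N : ℝ)⁻¹ * (Nat.sqrt N * Real.log (N + 1))) atTop (𝓝 0) := by
  have h0 : Tendsto (fun x : ℝ => Real.log x / x) atTop (𝓝 0) :=
    Real.isLittleO_log_id_atTop.tendsto_div_nhds_zero
  have h1 : Tendsto (fun N : ℕ => 4 * (Real.log ((Nat.sqrt N + 1 : ℕ) : ℝ) /
      ((Nat.sqrt N + 1 : ℕ) : ℝ))) atTop (𝓝 0) := by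
    have := (h0.comp (tendsto_natCast_atTop_atTop.comp
      ((tendsto_add_atTop_nat 1).comp Nat.tendsto_sqrt_atTop))).const_mul 4
    rwa [mul_zero] at this
  refine squeeze_zero' (Eventually.of_forall fun N => ?_) ?_ h1
  · have : 0 ≤ Real.log ((N : ℝ) + 1) := Real.log_nonneg (by simp)
    positivity
  filter_upwards [eventually_ge_atTop 1] with N hN
  set m := Nat.sqrt N with hmdef
  have hm : 1 ≤ m := Nat.sqrt_pos.2 hN
  have hm' : (1 : ℝ) ≤ m := by exact_mod_cast hm
  have hN' : (0 : ℝ) < N := by exact_mod_cast hN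
  have h : (m : ℝ) * m ≤ N := by exact_mod_cast Nat.sqrt_le N
  have h2 : (N : ℝ) + 1 ≤ ((m + 1 : ℕ) : ℝ) ^ 2 := by
    have : N < (m + 1) * (m + 1) := Nat.lt_succ_sqrt N
    rw [sq]
    exact_mod_cast this
  have h3 : Real.log (N + 1) ≤ 2 * Real.log ((m + 1 : ℕ) : ℝ) := by
    have := Real.log_le_log (by positivity) h2
    rwa [Real.log_pow] at this
  have hl : 0 ≤ Real.log ((m + 1 : ℕ) : ℝ) := Real.log_nonneg (by push_cast; linarith)
  rw [inv_mul_le_iff₀ hN', ← mul_div_assoc, ← mul_div_assoc, le_div_iff₀ (by positivity)]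
  calc (m : ℝ) * Real.log (N + 1) * ((m + 1 : ℕ) : ℝ)
      ≤ m * (2 * Real.log ((m + 1 : ℕ) : ℝ)) * (2 * m) := by
        gcongr
        push_cast
        linarith
    _ = (m * m) * (4 * Real.log ((m + 1 : ℕ) : ℝ)) := by ring
    _ ≤ N * (4 * Real.log ((m + 1 : ℕ) : ℝ)) := by gcongr

/-- Two positive sequences whose ratio is subexponentially controlled have the same
exponential rate. -/
lemma tendsto_inv_mul_log_sub {Z Z₀ : ℕ → ℝ} {C κ δ q : ℝ} (hC : 0 < C) (hκ : 0 < κ) (hδ : 0 < δ)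
    (hq0 : 0 ≤ q) (hq1 : q < 1)
    (h : ∀ᶠ N in atTop, 0 < Z₀ N ∧ Z N ≤ C * Z₀ N ∧
      κ * (δ ^ (2 * Nat.sqrt N) * (1 - q ^ Nat.sqrt N) ^ N) * Z₀ N ≤
        (((N : ℝ) + 1) ^ (4 * Nat.sqrt N)) ^ 2 * Z N) :
    Tendsto (fun N : ℕ => (N : ℝ)⁻¹ * (Real.log (Z N) - Real.log (Z₀ N))) atTop (𝓝 0) := by
  have hinv : Tendsto (fun N : ℕ => (N : ℝ)⁻¹) atTop (𝓝 0) :=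
    tendsto_inv_atTop_zero.comp tendsto_natCast_atTop_atTop
  have hup : Tendsto (fun N : ℕ => (N : ℝ)⁻¹ * Real.log C) atTop (𝓝 0) := by
    simpa using hinv.mul_const (Real.log C)
  have hpow : Tendsto (fun N : ℕ => Real.log (1 - q ^ Nat.sqrt N)) atTop (𝓝 0) := by
    have h1 : Tendsto (fun N : ℕ => 1 - q ^ Nat.sqrt N) atTop (𝓝 1) := by
      simpa using ((tendsto_pow_atTop_nhds_zero_of_lt_one hq0 hq1).comp
        Nat.tendsto_sqrt_atTop).const_sub 1
    simpa using h1.log one_ne_zero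
  have hlow : Tendsto (fun N : ℕ => (N : ℝ)⁻¹ * Real.log κ
      + 2 * Real.log δ * ((N : ℝ)⁻¹ * (Nat.sqrt N : ℝ)) + Real.log (1 - q ^ Nat.sqrt N)
      - 8 * ((N : ℝ)⁻¹ * (Nat.sqrt N * Real.log (N + 1)))) atTop (𝓝 0) := by
    simpa using (((hinv.mul_const (Real.log κ)).add
      (tendsto_sqrt_div.const_mul (2 * Real.log δ))).add hpow).sub
        (tendsto_sqrt_mul_log_div.const_mul 8)
  refine tendsto_of_tendsto_of_tendsto_of_le_of_le' hlow hup ?_ ?_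
  all_goals
    filter_upwards [h, eventually_ge_atTop 1] with N ⟨hZ₀, hle, hge⟩ hN
    have hm : Nat.sqrt N ≠ 0 := (Nat.sqrt_pos.2 hN).ne'
    have hN' : (0 : ℝ) < N := by exact_mod_cast hN
    have hqm : 0 < 1 - q ^ Nat.sqrt N := sub_pos.2 (pow_lt_one₀ hq0 hq1 hm)
    have hM : (0 : ℝ) < (((N : ℝ) + 1) ^ (4 * Nat.sqrt N)) ^ 2 := by positivity
    have hZ : 0 < Z N := pos_of_mul_pos_right (lt_of_lt_of_le (by positivity) hge) hM.le
  · have hlog := Real.log_le_log (by positivity) hge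
    rw [Real.log_mul (by positivity) hZ₀.ne', Real.log_mul hκ.ne' (by positivity),
      Real.log_mul (by positivity) (by positivity), Real.log_mul hM.ne' hZ.ne',
      Real.log_pow, Real.log_pow, Real.log_pow, Real.log_pow] at hlog
    push_cast at hlog
    rw [le_inv_mul_iff₀ hN']
    have e : (N : ℝ) * ((N : ℝ)⁻¹ * Real.log κ
      + 2 * Real.log δ * ((N : ℝ)⁻¹ * (Nat.sqrt N : ℝ)) + Real.log (1 - q ^ Nat.sqrt N)
      - 8 * ((N : ℝ)⁻¹ * (Nat.sqrt N * Real.log (N + 1)))) = Real.log κ +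
      2 * Nat.sqrt N * Real.log δ + N * Real.log (1 - q ^ Nat.sqrt N)
      - 8 * (Nat.sqrt N * Real.log (N + 1)) := by
      field_simp
    rw [e]
    linarith
  · have hlog := Real.log_le_log hZ hle
    rw [Real.log_mul hC.ne' hZ₀.ne'] at hlog
    gcongr
    linarith

end Limit

/-- Corollary 2.8: comparison of the two-layer weights for open ASEP and open TASEP summed over
configurations whose height profile lies in prescribed windows; the exponential rates agree. -/
theorem stmt10 (q a b c d : ℝ)
    (ha : 0 ≤ a) (hb : 0 ≤ b)
    (hc1 : -1 < c) (hc2 : c ≤ 0) (hd1 : -1 < d) (hd2 : d ≤ 0)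
    (hq0 : 0 ≤ q) (hq1 : q < 1) (hab : a * b < 1)
    (k : ℕ) (hk : 1 ≤ k) (θ u v : Fin (k+1) → ℝ)
    (hθ0 : 0 < θ 0) (hθmono : StrictMono θ) (hθlast : θ (Fin.last k) = 1)
    (hu0 : ∀ j, 0 < u j) (huv : ∀ j, u j < v j)
    (hgap : ∀ j : Fin k, v (Fin.last k) - u j.castSucc < 1 - θ j.castSucc)
    (hne : ∃ N₁ : ℕ, ∀ N : ℕ, N₁ ≤ N →
      (TLset N ∩ {p | ∀ j : Fin (k+1), heightTL N p.1 (θ j) ∈ Set.Ioo (u j) (v j)}).Nonempty) :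
    Filter.Tendsto
      (fun N : ℕ => (N : ℝ)⁻¹ *
        (Real.log (∑' p : TLset N,
            Set.indicator {p' | ∀ j : Fin (k+1), heightTL N p'.1 (θ j) ∈ Set.Ioo (u j) (v j)}
              (twt N q a b c d) p.val) -
         Real.log (∑' p : TLset N,
            Set.indicator {p' | ∀ j : Fin (k+1), heightTL N p'.1 (θ j) ∈ Set.Ioo (u j) (v j)}
              (twt0 N a b) p.val)))
      Filter.atTop (nhds 0) := by
  obtain ⟨k, rfl⟩ : ∃ k', k = k' + 1 := ⟨k - 1, by omega⟩
  have hδ : 0 < (1 - q) * (1 + c) * (1 + d) :=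
    mul_pos (mul_pos (by linarith) (by linarith)) (by linarith)
  refine tendsto_inv_mul_log_sub (Real.exp_pos (q / (1 - q) * (1 - q)⁻¹))
    (Real.exp_pos (-(c * d / (1 - c * d) * (1 - q)⁻¹))) hδ hq0 hq1 ?_
  have hgap' := hgap (Fin.last k)
  set i : Fin (k + 2) := (Fin.last k).castSucc with hi
  have hθi : ∀ j : Fin (k + 1), θ j.castSucc ≤ θ i := fun j =>
    hθmono.monotone (Fin.castSucc_le_castSucc_iff.2 (Fin.le_last j))
  have hθ1 : θ i < 1 := hθlast ▸ hθmono (Fin.castSucc_lt_last _)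
  have hθ0j : ∀ j, θ 0 ≤ θ j := fun j => hθmono.monotone (Fin.zero_le j)
  obtain ⟨N₁, hN₁⟩ := hne
  have ev1 : ∀ᶠ N : ℕ in Filter.atTop, (N : ℝ)⁻¹ * (Nat.sqrt N : ℝ) + (N : ℝ)⁻¹ < u 0 ∧
      (N : ℝ)⁻¹ * (Nat.sqrt N : ℝ) + (N : ℝ)⁻¹ < 1 - θ i - (v (Fin.last (k + 1)) - u i) := by
    have hlim : Filter.Tendsto (fun N : ℕ => (N : ℝ)⁻¹ * (Nat.sqrt N : ℝ) + (N : ℝ)⁻¹)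
        Filter.atTop (nhds 0) := by
      simpa using tendsto_sqrt_div.add
        (tendsto_inv_atTop_zero.comp (tendsto_natCast_atTop_atTop (R := ℝ)))
    exact (hlim.eventually_lt_const (hu0 0)).and
      (hlim.eventually_lt_const (by linarith))
  filter_upwards [ev1, Filter.eventually_ge_atTop N₁, Filter.eventually_ge_atTop 1] with
    N ⟨h_first, h_last⟩ hN hN1
  have hNpos : (0 : ℝ) < N := by exact_mod_cast hN1
  set V : Set ((Fin (N + 1) → ℤ) × (Fin (N + 1) → ℤ)) :=
    {p' | ∀ j : Fin (k + 1 + 1), heightTL N p'.1 (θ j) ∈ Set.Ioo (u j) (v j)} with hVdef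
  have hfloor : (⌊(N : ℝ) * θ 0⌋₊ : ℝ) ≤ N * θ 0 := Nat.floor_le (by positivity)
  have hfloor' : (N : ℝ) * θ 0 < ⌊(N : ℝ) * θ 0⌋₊ + 1 := Nat.lt_floor_add_one _
  have hceil : (N : ℝ) * θ i ≤ ⌈(N : ℝ) * θ i⌉₊ := Nat.le_ceil _
  have hθi0 : 0 ≤ θ i := hθ0.le.trans (hθ0j i)
  have hceil' : (⌈(N : ℝ) * θ i⌉₊ : ℝ) < N * θ i + 1 := Nat.ceil_lt_add_one (by positivity)
  have hKN : ⌈(N : ℝ) * θ i⌉₊ ≤ N := Nat.ceil_le.2 (mul_le_of_le_one_right hNpos.le hθ1.le)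
  have hK₀N : ⌊(N : ℝ) * θ 0⌋₊ < N := by
    rw [Nat.floor_lt (by positivity)]
    exact mul_lt_of_lt_one_right hNpos ((hθ0j i).trans_lt hθ1)
  let K₀' : Fin N := ⟨⌊(N : ℝ) * θ 0⌋₊, hK₀N⟩
  let K₀ : Fin (N + 1) := K₀'.castSucc
  let K : Fin (N + 1) := ⟨⌈(N : ℝ) * θ i⌉₊, by omega⟩
  have hK : K₀ ≤ K := by
    refine Fin.le_def.2 ((Nat.floor_le_ceil _).trans (Nat.ceil_mono ?_))
    exact mul_le_mul_of_nonneg_left (hθ0j i) hNpos.le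
  refine ⟨?_, tsum_twt_le hc1 hc2 hd1 hd2 hq0 hq1 ha hb hab V,
    mul_tsum_twt0_le hc1 hc2 hd1 hd2 hq0 hq1 ha hb hab V (Nat.sqrt N) hK ?_⟩
  · obtain ⟨⟨L, M⟩, ⟨hL0, hML, hL, hM⟩, hp⟩ := hN₁ N hN
    simp only at hL0 hL
    refine ((summable_twt0 ha hb hab).indicator_coe V).tsum_pos
      (fun p => Set.indicator_apply_nonneg fun _ => twt0_nonneg ha hb p.1)
      ⟨(L, L), hL0, fun _ => le_rfl, hL, hL⟩ ?_
    rw [Set.indicator_of_mem (show (L, L) ∈ V from hp)]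
    simp [twt0]
  · rintro ⟨L, M⟩ ⟨hL0, hML, hL, hM⟩ hp
    simp only at hL0 hML hL hM
    have hfix : ∀ j, heightTL N (raisePath (Nat.sqrt N) K₀ K L) (θ j) = heightTL N L (θ j) := by
      intro j
      induction j using Fin.lastCases with
      | last => rw [hθlast, heightTL_one, heightTL_one, raisePath_last hL hL0]
      | cast j =>
        refine heightTL_congr hK ((raisePath_zero hL hL0 _).trans hL0.symm)
          (fun j h1 h2 => raisePath_eq_self hL hL0 _ h1 h2) ?_ ?_
        · exact hfloor.trans (mul_le_mul_of_nonneg_left (hθ0j _) hNpos.le)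
        · exact (mul_le_mul_of_nonneg_left (hθi j) hNpos.le).trans hceil
    have g0 := (hp 0).1.trans_le (heightTL_le hL (i := K₀'.succ)
      (by simpa [K₀'] using hfloor'.le))
    have gi := (hp i).1.trans_le (heightTL_le hL (i := K) hceil)
    have gl := (hp (Fin.last (k + 1))).2
    rw [hθlast, heightTL_one] at gl
    rw [lt_inv_mul_iff₀ hNpos] at g0 gi
    rw [inv_mul_lt_iff₀ hNpos] at gl
    rw [← mul_add_one, inv_mul_lt_iff₀ hNpos] at h_first h_last
    refine ⟨?_, ?_, fun j => ?_⟩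
    · have hstep : L K₀'.succ ≤ L K₀ + 1 := by
        have := hL K₀'
        simp only [K₀]
        omega
      have hstep' : (L K₀'.succ : ℝ) ≤ L K₀ + 1 := by exact_mod_cast hstep
      have : (Nat.sqrt N : ℝ) ≤ L K₀ := by linarith
      exact_mod_cast this
    · have hKv : ((K : ℕ) : ℝ) < N * θ i + 1 := hceil'
      have : (Nat.sqrt N : ℝ) ≤ ((N : ℝ) - (K : ℕ)) - (L (Fin.last N) - L K) := by
        have e : (N : ℝ) * (1 - θ i - (v (Fin.last (k + 1)) - u i)) =
          N - N * θ i - N * v (Fin.last (k + 1)) + N * u i := by ring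
        linarith
      exact_mod_cast this
    · rw [hfix j]
      exact hp j
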